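/- Let (S_n) be a sequence of numerical semigroups such that R(S_n) is bounded above. Then liminf_{n→∞} μ(S_n) > 0. -/

import Mathlib

open Filter Topology Set

/-- A numerical set: a cofinite subset of ℕ containing 0, not all of ℕ. -/
def IsNumericalSet (T : Set ℕ) : Prop :=
  0 ∈ T ∧ Tᶜ.Finite ∧ Tᶜ.Nonempty

/-- A numerical semigroup: a numerical set closed under addition. -/
def IsNumericalSemigroup (S : Set ℕ) : Prop :=
  IsNumericalSet S ∧ ∀ a ∈ S, ∀ b ∈ S, a + b ∈ S

/-- Frobenius number: the largest element of the complement. -/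
noncomputable def frob (T : Set ℕ) : ℕ := sSup Tᶜ

/-- The associated semigroup `A(T) = {t | t + T ⊆ T}`. -/
def AT (T : Set ℕ) : Set ℕ := {t : ℕ | ∀ x ∈ T, t + x ∈ T}

/-- Multiplicity: the smallest positive element. -/
noncomputable def mult (S : Set ℕ) : ℕ := sInf {x | x ∈ S ∧ 0 < x}

/-- `R(S) = f(S) - m(S)` as an integer. -/
noncomputable def RVal (S : Set ℕ) : ℤ := (frob S : ℤ) - (mult S : ℤ)

/-- `P(S)`: the number of numerical sets whose associated semigroup is `S`. -/
noncomputable def PCount (S : Set ℕ) : ℕ :=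
  {T : Set ℕ | IsNumericalSet T ∧ AT T = S}.ncard

/-- The density `μ(S) = P(S) / 2^(f(S)-1)`. -/
noncomputable def density (S : Set ℕ) : ℝ :=
  (PCount S : ℝ) / 2 ^ (frob S - 1)

/-- The numerical semigroup `N(D,f) = {0} ∪ {f - l : l ∈ D} ∪ (f, ∞)`. -/
def NSet (D : Finset ℕ) (f : ℕ) : Set ℕ :=
  {0} ∪ (fun l => f - l) '' (D : Set ℕ) ∪ {x | f < x}

/-- `B(D,f)`: numerical sets `T` with `f(T) = f` and
`A(T) ∩ [f - Max D, f - 1] = {f - l : l ∈ D}`. -/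
def BSet (D : Finset ℕ) (f : ℕ) : Set (Set ℕ) :=
  {T | IsNumericalSet T ∧ frob T = f ∧
    AT T ∩ Set.Icc (f - D.sup id) (f - 1) = (fun l => f - l) '' (D : Set ℕ)}

/-- `A_D = |B(D, 2 Max D + 1)|`. -/
noncomputable def AConst (D : Finset ℕ) : ℕ :=
  (BSet D (2 * D.sup id + 1)).ncard

/-- `B_l(k,f) = {T ∈ B({k},f) : T ∩ [1,l] = ∅}`. -/
def BlSet (l k f : ℕ) : Set (Set ℕ) :=
  {T | T ∈ BSet {k} f ∧ T ∩ Set.Icc 1 l = ∅}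

/-- `C_{l,k}`. -/
noncomputable def CConst (l k : ℕ) : ℕ :=
  if l ≤ k then (BlSet l k (2 * k + 1)).ncard else (BlSet l k (l + k + 1)).ncard

/-- `G_l(f) = {T : A(T) = N_f, T ∩ [1,l] = ∅}`. -/
def GSet (l f : ℕ) : Set (Set ℕ) :=
  {T | IsNumericalSet T ∧ AT T = NSet ∅ f ∧ T ∩ Set.Icc 1 l = ∅}

theorem IsNumericalSet.frob_notMem {T : Set ℕ} (hT : IsNumericalSet T) : frob T ∉ T :=
  Nat.sSup_mem hT.2.2 hT.2.1.bddAbove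

theorem IsNumericalSet.mem_of_frob_lt {T : Set ℕ} (hT : IsNumericalSet T) {x : ℕ}
    (hx : frob T < x) : x ∈ T := by
  by_contra h
  exact absurd (le_csSup hT.2.1.bddAbove h) (not_le.mpr hx)

theorem IsNumericalSet.frob_pos {T : Set ℕ} (hT : IsNumericalSet T) : 0 < frob T := by
  rcases Nat.eq_zero_or_pos (frob T) with h | h
  · exact absurd (h ▸ hT.1) hT.frob_notMem
  · exact h

theorem AT_subset {T : Set ℕ} (h0 : 0 ∈ T) : AT T ⊆ T := fun t ht => by
  simpa using ht 0 h0

theorem mul_mem_AT {T : Set ℕ} {t : ℕ} (ht : t ∈ AT T) (q : ℕ) : q * t ∈ AT T := by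
  induction q with
  | zero => intro x hx; simpa using hx
  | succ q ih =>
    intro x hx
    have := ih _ (ht x hx)
    rwa [← add_assoc, ← Nat.succ_mul] at this

theorem AT_eq_self {S : Set ℕ} (hS : IsNumericalSemigroup S) : AT S = S :=
  (AT_subset hS.1.1).antisymm fun s hs x hx => hS.2 s hs x hx

/-- The Frobenius number of `A(T)` has the defining properties of the Frobenius number of `T`. -/
theorem frob_notMem_and_mem_of_AT_eq {S T : Set ℕ} (hS : IsNumericalSet S)
    (hT : IsNumericalSet T) (h : AT T = S) :
    frob S ∉ T ∧ ∀ x, frob S < x → x ∈ T := by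
  have hgt : ∀ x, frob S < x → x ∈ T := fun x hx =>
    AT_subset hT.1 (h ▸ hS.mem_of_frob_lt hx)
  refine ⟨fun hf => hS.frob_notMem ?_, hgt⟩
  suffices hA : frob S ∈ AT T from h ▸ hA
  intro x hx
  rcases Nat.eq_zero_or_pos x with rfl | hx0
  · simpa using hf
  · exact hgt _ (by omega)

/-- The trace of `T` on `[1, f(S) - 1]`. -/
noncomputable def innerTrace (S T : Set ℕ) : Finset ℕ := by
  classical exact (Finset.Ico 1 (frob S)).filter (· ∈ T)

theorem innerTrace_injOn {S : Set ℕ} (hS : IsNumericalSet S) :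
    InjOn (innerTrace S) {T | IsNumericalSet T ∧ AT T = S} := by
  rintro T ⟨hT, hTS⟩ T' ⟨hT', hTS'⟩ h
  obtain ⟨h1, h2⟩ := frob_notMem_and_mem_of_AT_eq hS hT hTS
  obtain ⟨h1', h2'⟩ := frob_notMem_and_mem_of_AT_eq hS hT' hTS'
  ext x
  rcases Nat.eq_zero_or_pos x with rfl | hx0
  · simp [hT.1, hT'.1]
  rcases lt_trichotomy x (frob S) with hx | rfl | hx
  · have := congrArg (x ∈ ·) h
    simpa [innerTrace, hx, Nat.one_le_iff_ne_zero, hx0.ne'] using this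
  · simp [h1, h1']
  · simp [h2 x hx, h2' x hx]

theorem innerTrace_mapsTo (S : Set ℕ) (A : Set (Set ℕ)) :
    MapsTo (innerTrace S) A ((Finset.Ico 1 (frob S)).powerset : Finset (Finset ℕ)) := by
  intro T _
  classical
  rw [Finset.mem_coe, Finset.mem_powerset]
  unfold innerTrace
  exact Finset.filter_subset _ _

theorem finite_setOf_AT_eq {S : Set ℕ} (hS : IsNumericalSet S) :
    {T | IsNumericalSet T ∧ AT T = S}.Finite :=
  Set.Finite.of_injOn (innerTrace_mapsTo S _) (innerTrace_injOn hS) (Finset.finite_toSet _)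

theorem PCount_le {S : Set ℕ} (hS : IsNumericalSet S) : PCount S ≤ 2 ^ (frob S - 1) := by
  have := Set.ncard_le_ncard_of_injOn _ (innerTrace_mapsTo S _) (innerTrace_injOn hS)
    (Finset.finite_toSet _)
  rwa [Set.ncard_coe_finset, Finset.card_powerset, Nat.card_Ico] at this

theorem density_le_one {S : Set ℕ} (hS : IsNumericalSet S) : density S ≤ 1 := by
  unfold density
  rw [div_le_one (by positivity)]
  exact_mod_cast PCount_le hS

theorem PCount_pos {S : Set ℕ} (hS : IsNumericalSemigroup S) : 0 < PCount S :=
  (Set.ncard_pos (finite_setOf_AT_eq hS.1)).mpr ⟨S, hS.1, AT_eq_self hS⟩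

/-- The subsets `X` of `U` such that `x ∈ X` implies `x + t ∈ X` for all `x ∈ I`. -/
def shiftClosed (U I : Finset ℕ) (t : ℕ) : Finset (Finset ℕ) :=
  U.powerset.filter fun X => ∀ x ∈ I, x ∈ X → x + t ∈ X

theorem mem_shiftClosed {U I X : Finset ℕ} {t : ℕ} :
    X ∈ shiftClosed U I t ↔ X ⊆ U ∧ ∀ x ∈ I, x ∈ X → x + t ∈ X := by
  simp [shiftClosed]

theorem four_mul_card_shiftClosed_insert_le {U I : Finset ℕ} {t a : ℕ} (haU : a ∈ U) (haI : a ∉ I)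
    (ht : ∀ x ∈ insert a I, x + t ∉ insert a I) :
    4 * (shiftClosed U (insert a I) t).card ≤ 3 * (shiftClosed U I t).card := by
  set B := (shiftClosed U I t).filter fun X => a ∈ X ∧ a + t ∉ X with hB
  have hat : a + t ∉ insert a I := ht a (by simp)
  have hne : a + t ≠ a := fun h => hat (by simp [h])
  have hmaps : ∀ X ∈ shiftClosed U I t, insert a (X.erase (a + t)) ∈ B := by
    intro X hX
    obtain ⟨hXU, hX⟩ := mem_shiftClosed.mp hX
    rw [hB, Finset.mem_filter, mem_shiftClosed]
    refine ⟨⟨?_, ?_⟩, by simp, by simpa using hne⟩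
    · exact Finset.insert_subset haU ((Finset.erase_subset _ _).trans hXU)
    · intro x hx hxX
      have hxa : x ≠ a := fun h => haI (h ▸ hx)
      rw [Finset.mem_insert, Finset.mem_erase] at hxX ⊢
      refine Or.inr ⟨by omega, hX x hx ?_⟩
      tauto
  have hfib : ∀ Y ∈ B, ((shiftClosed U I t).filter
      fun X => insert a (X.erase (a + t)) = Y).card ≤ 4 := by
    intro Y _
    have hsub : (shiftClosed U I t).filter (fun X => insert a (X.erase (a + t)) = Y) ⊆
        {Y, Y.erase a, insert (a + t) Y, insert (a + t) (Y.erase a)} := by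
      intro X hX
      obtain rfl := (Finset.mem_filter.mp hX).2
      simp only [Finset.mem_insert, Finset.mem_singleton]
      by_cases h1 : a ∈ X <;> by_cases h2 : a + t ∈ X
      · refine Or.inr (Or.inr (Or.inl ?_)); ext y; simp; grind
      · refine Or.inl ?_; ext y; simp; grind
      · refine Or.inr (Or.inr (Or.inr ?_)); ext y; simp; grind
      · refine Or.inr (Or.inl ?_); ext y; simp; grind
    exact (Finset.card_le_card hsub).trans Finset.card_le_four
  have hcard : (shiftClosed U I t).card ≤ 4 * B.card :=
    Finset.card_le_mul_card_image_of_maps_to hmaps 4 hfib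
  have hsplit : shiftClosed U (insert a I) t =
      (shiftClosed U I t).filter fun X => ¬ (a ∈ X ∧ a + t ∉ X) := by
    ext X
    simp only [mem_shiftClosed, Finset.mem_filter, Finset.forall_mem_insert]
    tauto
  have hsum := Finset.card_filter_add_card_filter_not (s := shiftClosed U I t)
    (fun X => a ∈ X ∧ a + t ∉ X)
  rw [← hB] at hsum
  rw [hsplit]
  omega

theorem four_pow_mul_card_shiftClosed_le {U : Finset ℕ} {t : ℕ} (I : Finset ℕ) (hIU : I ⊆ U)
    (ht : ∀ x ∈ I, x + t ∉ I) :
    4 ^ I.card * (shiftClosed U I t).card ≤ 3 ^ I.card * 2 ^ U.card := by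
  induction I using Finset.induction_on with
  | empty => simp [shiftClosed]
  | insert a I ha ih =>
    have h1 := ih ((Finset.subset_insert _ _).trans hIU) fun x hx h =>
      ht x (Finset.mem_insert_of_mem hx) (Finset.mem_insert_of_mem h)
    have h2 := four_mul_card_shiftClosed_insert_le (hIU (Finset.mem_insert_self a I)) ha ht
    rw [Finset.card_insert_of_notMem ha, pow_succ, pow_succ]
    calc 4 ^ I.card * 4 * (shiftClosed U (insert a I) t).card
        = 4 ^ I.card * (4 * (shiftClosed U (insert a I) t).card) := by ring
      _ ≤ 4 ^ I.card * (3 * (shiftClosed U I t).card) := by gcongr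
      _ = 3 * (4 ^ I.card * (shiftClosed U I t).card) := by ring
      _ ≤ 3 * (3 ^ I.card * 2 ^ U.card) := by gcongr
      _ = _ := by ring

theorem card_shiftClosed_le {U I : Finset ℕ} {t : ℕ} (hIU : I ⊆ U) (ht : ∀ x ∈ I, x + t ∉ I) :
    ((shiftClosed U I t).card : ℝ) ≤ (3 / 4) ^ I.card * 2 ^ U.card := by
  have h : (4 : ℝ) ^ I.card * (shiftClosed U I t).card ≤ 3 ^ I.card * 2 ^ U.card := by
    exact_mod_cast four_pow_mul_card_shiftClosed_le I hIU ht
  rw [div_pow, div_mul_eq_mul_div, le_div_iff₀ (by positivity)]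
  linarith

theorem sum_pow_half_le (n : ℕ) : ∑ i ∈ Finset.range n, (3 / 4 : ℝ) ^ (i / 2) ≤ 8 := by
  have h : ∀ m : ℕ, ∑ i ∈ Finset.range (2 * m), (3 / 4 : ℝ) ^ (i / 2) = 8 * (1 - (3 / 4) ^ m) := by
    intro m
    induction m with
    | zero => simp
    | succ m ih =>
      rw [Nat.mul_succ, Finset.sum_range_succ, Finset.sum_range_succ, ih,
        show (2 * m + 1) / 2 = m by omega, show 2 * m / 2 = m by omega]
      ring
  calc ∑ i ∈ Finset.range n, (3 / 4 : ℝ) ^ (i / 2)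
      ≤ ∑ i ∈ Finset.range (2 * n), (3 / 4 : ℝ) ^ (i / 2) :=
        Finset.sum_le_sum_of_subset_of_nonneg (Finset.range_mono (by omega))
          fun _ _ _ => by positivity
    _ = 8 * (1 - (3 / 4) ^ n) := h n
    _ ≤ 8 := by linarith [show (0 : ℝ) ≤ (3 / 4) ^ n by positivity]

/-- Every positive `t < f` with `t < b`, where `2 f ≤ 3 b`, has a multiple in `[f / 3, b)`. -/
theorem exists_mul_mem_third {f b t : ℕ} (h0 : 0 < t) (htb : t < b) (hb : 2 * f ≤ 3 * b) :
    ∃ q, f ≤ 3 * (q * t) ∧ 0 < q * t ∧ q * t < b := by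
  by_cases h : f ≤ 3 * t
  · exact ⟨1, by omega, by omega, by omega⟩
  have hex : ∃ q, f ≤ 3 * (q * t) := ⟨f, by nlinarith⟩
  classical
  have hq := Nat.find_spec hex
  have hq0 : Nat.find hex ≠ 0 := fun h' => by rw [h'] at hq; omega
  obtain ⟨p, hp⟩ := Nat.exists_eq_succ_of_ne_zero hq0
  have hmin := Nat.find_min hex (m := p) (by omega)
  rw [hp, Nat.succ_mul] at hq
  refine ⟨p + 1, ?_, ?_, ?_⟩ <;> rw [Nat.succ_mul] <;> omega

/-- The block of `(f - s) / 2 - (M + 1)` integers just above `M`. -/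
def lowBlock (M f s : ℕ) : Finset ℕ := Finset.Ioc M ((f - s) / 2 - 1)

theorem union_mem_of_forall_notMem_shiftClosed {S : Set ℕ} (hS : IsNumericalSemigroup S) {M K : ℕ}
    (hgap : ∀ x ∈ S, 0 < x → frob S ≤ x + M) (hK : 2 * M + 2 ≤ K) (hf : 3 * K ≤ frob S)
    {X : Finset ℕ} (hXU : X ⊆ Finset.Ioo M (frob S - K))
    (hX : ∀ k ∈ Finset.Ioc K (frob S), frob S ≤ 3 * (frob S - k) →
      X ∉ shiftClosed (Finset.Ioo M (frob S - K)) (lowBlock M (frob S) (frob S - k))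
        (frob S - k)) :
    IsNumericalSet (S ∪ X) ∧ AT (S ∪ X) = S := by
  have hbd : ∀ x ∈ X, M < x ∧ x < frob S - K := fun x hx => Finset.mem_Ioo.mp (hXU hx)
  have hT : IsNumericalSet (S ∪ X) := by
    refine ⟨Or.inl hS.1.1, hS.1.2.1.subset (compl_subset_compl.mpr subset_union_left),
      frob S, ?_⟩
    rintro (h | h)
    · exact hS.1.frob_notMem h
    · have := hbd _ h; omega
  refine ⟨hT, Subset.antisymm ?_ ?_⟩
  · intro t ht
    by_contra htS
    have htX : t ∈ X := (AT_subset hT.1 ht).resolve_left htS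
    have htb := hbd t htX
    obtain ⟨q, hq1, hq2, hq3⟩ := exists_mul_mem_third (f := frob S) (b := frob S - K) (t := t)
      (by omega) htb.2 (by omega)
    have hs := mul_mem_AT ht q
    generalize q * t = s at *
    have hk : frob S - (frob S - s) = s := by omega
    refine hX (frob S - s) (Finset.mem_Ioc.mpr (by omega)) (by omega) ?_
    rw [hk, mem_shiftClosed]
    refine ⟨hXU, fun x hx hxX => ?_⟩
    rw [lowBlock, Finset.mem_Ioc] at hx
    rcases hs x (Or.inr hxX) with h | h
    · have := hgap _ h (by omega)
      omega
    · rwa [add_comm] at h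
  · intro s hs x hx
    rcases hx with hx | hx
    · exact Or.inl (hS.2 s hs x hx)
    · rcases Nat.eq_zero_or_pos s with rfl | hs0
      · rw [zero_add]; exact Or.inr hx
      · have := hbd x hx
        have := hgap s hs hs0
        exact Or.inl (hS.1.mem_of_frob_lt (by omega))

theorem card_shiftClosed_lowBlock_le {M K f k : ℕ} (hK : K = 2 * M + 22) (hf : 3 * K ≤ f)
    (hk : k ∈ Finset.Ioc K f) (h3 : f ≤ 3 * (f - k)) :
    ((shiftClosed (Finset.Ioo M (f - K)) (lowBlock M f (f - k)) (f - k)).card : ℝ) ≤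
      (3 / 4) ^ 10 * (3 / 4) ^ ((k - (K + 1)) / 2) * 2 ^ (Finset.Ioo M (f - K)).card := by
  rw [Finset.mem_Ioc] at hk
  have hkk : f - (f - k) = k := by omega
  refine (card_shiftClosed_le ?_ ?_).trans ?_
  · intro x hx
    rw [lowBlock, Finset.mem_Ioc] at hx
    rw [Finset.mem_Ioo]
    omega
  · intro x hx h
    rw [lowBlock, Finset.mem_Ioc] at hx h
    omega
  · rw [← pow_add]
    gcongr ?_ * _
    refine pow_le_pow_of_le_one (by norm_num) (by norm_num) ?_
    rw [lowBlock, Nat.card_Ioc]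
    omega

theorem two_pow_le_two_mul_PCount {S : Set ℕ} (hS : IsNumericalSemigroup S) {M K : ℕ}
    (hgap : ∀ x ∈ S, 0 < x → frob S ≤ x + M) (hK : K = 2 * M + 22) (hf : 3 * K ≤ frob S) :
    (2 : ℝ) ^ (Finset.Ioo M (frob S - K)).card ≤ 2 * PCount S := by
  classical
  set f := frob S with hfdef
  set U := Finset.Ioo M (f - K) with hU
  set Ks := (Finset.Ioc K f).filter fun k => f ≤ 3 * (f - k) with hKs
  set bad := Ks.biUnion fun k => shiftClosed U (lowBlock M f (f - k)) (f - k) with hbad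
  have hbadcard : (bad.card : ℝ) ≤ 2 ^ U.card / 2 := by
    calc (bad.card : ℝ)
        ≤ ∑ k ∈ Ks, ((shiftClosed U (lowBlock M f (f - k)) (f - k)).card : ℝ) := by
          exact_mod_cast Finset.card_biUnion_le
      _ ≤ ∑ k ∈ Ks, (3 / 4 : ℝ) ^ 10 * (3 / 4) ^ ((k - (K + 1)) / 2) * 2 ^ U.card := by
          refine Finset.sum_le_sum fun k hk => ?_
          rw [hKs, Finset.mem_filter] at hk
          exact card_shiftClosed_lowBlock_le hK hf hk.1 hk.2
      _ ≤ ∑ k ∈ Finset.Ico (K + 1) (f + 1),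
            (3 / 4 : ℝ) ^ 10 * (3 / 4) ^ ((k - (K + 1)) / 2) * 2 ^ U.card := by
          refine Finset.sum_le_sum_of_subset_of_nonneg ?_ fun _ _ _ => by positivity
          intro k hk
          rw [hKs, Finset.mem_filter, Finset.mem_Ioc] at hk
          rw [Finset.mem_Ico]
          omega
      _ = (3 / 4 : ℝ) ^ 10 * (∑ i ∈ Finset.range (f + 1 - (K + 1)), (3 / 4 : ℝ) ^ (i / 2)) *
            2 ^ U.card := by
          rw [Finset.sum_Ico_eq_sum_range, Finset.mul_sum, Finset.sum_mul]
          simp only [Nat.add_sub_cancel_left]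
      _ ≤ (3 / 4 : ℝ) ^ 10 * 8 * 2 ^ U.card := by
          gcongr
          exact sum_pow_half_le _
      _ ≤ 2 ^ U.card / 2 := by
          have : (0 : ℝ) < 2 ^ U.card := by positivity
          norm_num
          linarith
  have hgood : (U.powerset \ bad).card ≤ PCount S := by
    rw [← Set.ncard_coe_finset]
    refine Set.ncard_le_ncard_of_injOn (fun X : Finset ℕ => S ∪ X) ?_ ?_ (finite_setOf_AT_eq hS.1)
    · intro X hX
      rw [Finset.mem_coe, Finset.mem_sdiff, Finset.mem_powerset] at hX
      refine union_mem_of_forall_notMem_shiftClosed hS hgap (by omega) hf hX.1 fun k hk h3 h => ?_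
      exact hX.2 (Finset.mem_biUnion.mpr ⟨k, Finset.mem_filter.mpr ⟨hk, h3⟩, h⟩)
    · have hdisj : ∀ x ∈ U, x ∉ S := by
        intro x hx hxS
        rw [hU, Finset.mem_Ioo] at hx
        have := hgap x hxS (by omega)
        omega
      have key : ∀ X ∈ U.powerset \ bad, ∀ Y : Finset ℕ, S ∪ (X : Set ℕ) = S ∪ Y → X ⊆ Y := by
        intro X hX Y h x hx
        rw [Finset.mem_sdiff, Finset.mem_powerset] at hX
        have : x ∈ S ∪ (Y : Set ℕ) := h ▸ Or.inr hx
        exact this.resolve_left (hdisj x (hX.1 hx))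
      intro X hX Y hY h
      exact (key X hX Y h).antisymm (key Y hY X h.symm)
  have hsub : U.powerset.card - bad.card ≤ (U.powerset \ bad).card := Finset.le_card_sdiff _ _
  rw [Finset.card_powerset] at hsub
  have hsum : (2 : ℝ) ^ U.card ≤ PCount S + bad.card := by
    exact_mod_cast (by omega : 2 ^ U.card ≤ PCount S + bad.card)
  linarith

theorem inv_two_pow_le_density {S : Set ℕ} (hS : IsNumericalSemigroup S) {M : ℕ}
    (hgap : ∀ x ∈ S, 0 < x → frob S ≤ x + M) :
    1 / (2 : ℝ) ^ (3 * (2 * M + 22)) ≤ density S := by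
  have hpos := hS.1.frob_pos
  unfold density
  rw [div_le_div_iff₀ (by positivity) (by positivity), one_mul]
  rcases le_total (frob S) (3 * (2 * M + 22)) with hf | hf
  · have h1 : (1 : ℝ) ≤ PCount S := by exact_mod_cast PCount_pos hS
    calc (2 : ℝ) ^ (frob S - 1) ≤ 2 ^ (3 * (2 * M + 22)) :=
          pow_le_pow_right₀ (by norm_num) (by omega)
      _ ≤ _ := le_mul_of_one_le_left (by positivity) h1
  · have h := two_pow_le_two_mul_PCount hS hgap rfl hf
    rw [Nat.card_Ioo] at h
    calc (2 : ℝ) ^ (frob S - 1)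
        ≤ 2 ^ ((frob S - (2 * M + 22) - M - 1) + (3 * (2 * M + 22) - 1)) :=
          pow_le_pow_right₀ (by norm_num) (by omega)
      _ = 2 ^ (frob S - (2 * M + 22) - M - 1) * 2 ^ (3 * (2 * M + 22) - 1) := pow_add _ _ _
      _ ≤ 2 * PCount S * 2 ^ (3 * (2 * M + 22) - 1) := by gcongr
      _ = PCount S * 2 ^ (3 * (2 * M + 22) - 1 + 1) := by ring
      _ = _ := by rw [Nat.sub_add_cancel (by omega)]

theorem stmt18 (S : ℕ → Set ℕ) (hS : ∀ n, IsNumericalSemigroup (S n))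
    (hbdd : ∃ M : ℤ, ∀ n, RVal (S n) ≤ M) :
    0 < Filter.liminf (fun n => density (S n)) atTop := by
  obtain ⟨M, hM⟩ := hbdd
  have hgap : ∀ n, ∀ x ∈ S n, 0 < x → frob (S n) ≤ x + M.toNat := by
    intro n x hx hx0
    have h1 : mult (S n) ≤ x := Nat.sInf_le ⟨hx, hx0⟩
    have h2 := hM n
    unfold RVal at h2
    omega
  refine lt_of_lt_of_le (by positivity : (0 : ℝ) < 1 / 2 ^ (3 * (2 * M.toNat + 22))) ?_
  refine le_liminf_of_le ?_ (Eventually.of_forall fun n => inv_two_pow_le_density (hS n) (hgap n))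
  exact IsBoundedUnder.isCoboundedUnder_ge
    (isBoundedUnder_of ⟨1, fun n => density_le_one (hS n).1⟩)
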